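/- For any finite nonempty simple graphs G and H without isolated vertices, γ(G □ H) ≥ (Δ(G)/(2·Δ(G)−1)) · γ(G) · γ(H), where Δ(G) denotes the maximum degree of G. -/

import Mathlib

open Finset

/-- `s` is a dominating set of `G`: every vertex is in `s` or adjacent to a vertex of `s`. -/
def IsDominatingSet {V : Type*} (G : SimpleGraph V) (s : Set V) : Prop :=
  ∀ v : V, v ∈ s ∨ ∃ u ∈ s, G.Adj u v

/-- The domination number `γ(G)`: minimum cardinality of a dominating set. -/
noncomputable def domNum {V : Type*} [Fintype V] (G : SimpleGraph V) : ℕ :=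
  sInf {n : ℕ | ∃ s : Set V, IsDominatingSet G s ∧ s.ncard = n}

/-- The allegiance `a_G(D) = max_{v ∈ V} |D ∩ N[v]|` (closed neighborhoods). -/
noncomputable def allegiance {V : Type*} [Fintype V] (G : SimpleGraph V) (D : Set V) : ℕ :=
  Finset.univ.sup fun v : V => (D ∩ (insert v (G.neighborSet v))).ncard

/-- The power `π(G)`: minimum allegiance over all minimum dominating sets (γ-sets) of `G`. -/
noncomputable def graphPower {V : Type*} [Fintype V] (G : SimpleGraph V) : ℕ :=
  sInf {a : ℕ | ∃ D : Set V, IsDominatingSet G D ∧ D.ncard = domNum G ∧ allegiance G D = a}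

open Classical in
lemma domNum_le_card {V : Type*} [Fintype V] {G : SimpleGraph V} {s : Finset V}
    (hs : ∀ v, v ∈ s ∨ ∃ u ∈ s, G.Adj u v) : domNum G ≤ #s :=
  Nat.sInf_le ⟨(s : Set V), fun v => by simpa using hs v, Set.ncard_coe_finset s⟩

open Classical in
lemma exists_card_eq_domNum {V : Type*} [Fintype V] (G : SimpleGraph V) :
    ∃ s : Finset V, (∀ v, v ∈ s ∨ ∃ u ∈ s, G.Adj u v) ∧ #s = domNum G := by
  obtain ⟨s, hs, hcard⟩ := Nat.sInf_mem
    (⟨_, Set.univ, fun v => Or.inl (Set.mem_univ v), rfl⟩ :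
      {n : ℕ | ∃ s : Set V, IsDominatingSet G s ∧ s.ncard = n}.Nonempty)
  refine ⟨s.toFinset, fun v => by simpa using hs v, ?_⟩
  rw [← Set.ncard_eq_toFinset_card']
  exact hcard

open Classical in
/-- In a graph without isolated vertices, every vertex of a minimum dominating set has a neighbor
outside that set. -/
lemma exists_adj_notMem_of_card_eq_domNum {V : Type*} [Fintype V] {G : SimpleGraph V}
    (hG : ∀ v : V, ∃ u : V, G.Adj u v) {D : Finset V}
    (hD : ∀ v, v ∈ D ∨ ∃ u ∈ D, G.Adj u v) (hcard : #D = domNum G) {b : V} (hb : b ∈ D) :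
    ∃ x ∉ D, G.Adj b x := by
  by_contra! h
  have key : ∀ x, G.Adj b x → x ∈ D := fun x hx => by
    by_contra hxD
    exact h x hxD hx
  have hdom : ∀ v, v ∈ D.erase b ∨ ∃ u ∈ D.erase b, G.Adj u v := by
    intro v
    by_cases hvb : v = b
    · subst hvb
      obtain ⟨u, hu⟩ := hG v
      exact Or.inr ⟨u, mem_erase.2 ⟨hu.ne, key u hu.symm⟩, hu⟩
    · rcases hD v with hv | ⟨u, hu, huv⟩
      · exact Or.inl (mem_erase.2 ⟨hvb, hv⟩)
      · by_cases hub : u = b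
        · subst hub
          exact Or.inl (mem_erase.2 ⟨hvb, key v huv⟩)
        · exact Or.inr ⟨u, mem_erase.2 ⟨hub, hu⟩, huv⟩
  have := domNum_le_card hdom
  have := card_erase_lt_of_mem hb
  omega

lemma Fintype.card_filter_piFinset_le_mul {ι α : Type*} [Fintype ι] [DecidableEq ι]
    [DecidableEq α] {A : ι → Finset α} {P : (ι → α) → Prop} [DecidablePred P] {i : ι} {a : α} (ha : a ∈ A i)
    (hP : ∀ f, P f → P (Function.update f i a)) :
    #{f ∈ Fintype.piFinset A | P f} ≤ #(A i) * #{f ∈ Fintype.piFinset A | P f ∧ f i = a} := by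
  refine card_le_mul_card_image_of_maps_to (f := fun f => Function.update f i a) ?_ _ ?_
  · intro f hf
    simp only [mem_filter, Fintype.mem_piFinset] at hf ⊢
    refine ⟨fun j => ?_, hP f hf.2, by simp⟩
    by_cases hj : j = i
    · subst hj
      simpa using ha
    · simpa [hj] using hf.1 j
  · intro g _
    refine card_le_card_of_injOn (fun f => f i) ?_ ?_
    · intro f hf
      simp only [coe_filter, mem_filter, Fintype.mem_piFinset, Set.mem_ofPred_eq] at hf
      exact hf.1.1 i
    · intro f hf f' hf' h
      simp only [coe_filter, mem_filter, Set.mem_ofPred_eq] at hf hf'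
      funext j
      by_cases hj : j = i
      · subst hj
        exact h
      · have := congrFun (hf.2.trans hf'.2.symm) j
        simpa [hj] using this

section Labelings

open Classical in
/-- The labels available at a vertex `x`: the vertex itself if it lies in `D`, and its neighbors
in `D` otherwise. -/
noncomputable def labels {V : Type*} (G : SimpleGraph V) (D : Finset V) (x : V) : Finset V :=
  if x ∈ D then {x} else {u ∈ D | G.Adj x u}

open Classical in
/-- The `u ∈ D` with `(u, h) ∉ S` that label no vertex of `S` in a fiber adjacent to `h`. -/
noncomputable def unlabeledVertically {V W : Type*} (H : SimpleGraph W)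
    (D : Finset V) (S : Finset (V × W)) (f : V × W → V) (h : W) : Finset V :=
  {u ∈ D | (u, h) ∉ S ∧ ∀ p ∈ S, H.Adj p.2 h → f p ≠ u}

open Classical in
/-- The vertices of `unlabeledVertically` that label no vertex of `S` in the fiber of `h`. -/
noncomputable def unlabeled {V W : Type*} (H : SimpleGraph W)
    (D : Finset V) (S : Finset (V × W)) (f : V × W → V) (h : W) : Finset V :=
  {u ∈ unlabeledVertically H D S f h | ∀ p ∈ S, p.2 = h → f p ≠ u}

variable {V W : Type*} {G : SimpleGraph V} {H : SimpleGraph W} {D : Finset V}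
  {S : Finset (V × W)} {f : V × W → V}

lemma mem_unlabeledVertically {u : V} {h : W} : u ∈ unlabeledVertically H D S f h ↔
    u ∈ D ∧ (u, h) ∉ S ∧ ∀ p ∈ S, H.Adj p.2 h → f p ≠ u := by
  simp [unlabeledVertically]

lemma mem_unlabeled {u : V} {h : W} : u ∈ unlabeled H D S f h ↔
    u ∈ unlabeledVertically H D S f h ∧ ∀ p ∈ S, p.2 = h → f p ≠ u := by
  simp [unlabeled]

lemma unlabeledVertically_subset {h : W} : unlabeledVertically H D S f h ⊆ D :=
  fun _ hu => (mem_unlabeledVertically.1 hu).1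

lemma unlabeled_subset {h : W} : unlabeled H D S f h ⊆ unlabeledVertically H D S f h :=
  fun _ hu => (mem_unlabeled.1 hu).1

lemma labels_of_mem {x : V} (hx : x ∈ D) : labels G D x = {x} := if_pos hx

lemma mem_labels_of_notMem {x u : V} (hx : x ∉ D) :
    u ∈ labels G D x ↔ u ∈ D ∧ G.Adj x u := by
  simp [labels, hx]

lemma mem_of_mem_labels {x u : V} (h : u ∈ labels G D x) : u ∈ D := by
  by_cases hx : x ∈ D
  · rw [labels_of_mem hx, mem_singleton] at h
    exact h ▸ hx
  · exact ((mem_labels_of_notMem hx).1 h).1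

lemma eq_or_adj_of_mem_labels {x u : V} (h : u ∈ labels G D x) : x = u ∨ G.Adj u x := by
  by_cases hx : x ∈ D
  · rw [labels_of_mem hx, mem_singleton] at h
    exact Or.inl h.symm
  · exact Or.inr ((mem_labels_of_notMem hx).1 h).2.symm

lemma labels_nonempty (hD : ∀ v, v ∈ D ∨ ∃ u ∈ D, G.Adj u v) (x : V) :
    (labels G D x).Nonempty := by
  by_cases hx : x ∈ D
  · exact ⟨x, by simp [labels_of_mem hx]⟩
  · obtain ⟨u, hu, hux⟩ := (hD x).resolve_left hx
    exact ⟨u, (mem_labels_of_notMem hx).2 ⟨hu, hux.symm⟩⟩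

open Classical in
lemma card_mul_domNum_le [Fintype W] (hf : ∀ p, f p ∈ labels G D p.1) :
    #D * domNum H ≤ #S + ∑ h, #(unlabeled H D S f h) := by
  have hcell : ∀ u ∈ D, domNum H ≤ #{p ∈ S | f p = u} + #{h | u ∈ unlabeled H D S f h} := by
    intro u hu
    set P : Finset W := image Prod.snd {p ∈ S | f p = u} ∪
      ({h | u ∈ unlabeled H D S f h} : Finset W)
    have hdom : ∀ h, h ∈ P ∨ ∃ k ∈ P, H.Adj k h := by
      intro h
      by_cases hL : u ∈ unlabeled H D S f h
      · exact Or.inl (mem_union_right _ (by simpa using hL))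
      have himg : ∀ p ∈ S, f p = u →
          p.2 ∈ P := fun p hp hpu =>
        mem_union_left _ (mem_image_of_mem _ (mem_filter.2 ⟨hp, hpu⟩))
      by_cases huS : (u, h) ∈ S
      · have hlab := hf (u, h)
        rw [labels_of_mem hu, mem_singleton] at hlab
        exact Or.inl (himg _ huS hlab)
      by_cases hLv : u ∈ unlabeledVertically H D S f h
      · obtain ⟨p, hp, rfl, hpu⟩ : ∃ p ∈ S, p.2 = h ∧ f p = u := by
          by_contra! hne
          exact hL (mem_unlabeled.2 ⟨hLv, hne⟩)
        exact Or.inl (himg p hp hpu)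
      · obtain ⟨p, hp, hadj, hpu⟩ : ∃ p ∈ S, H.Adj p.2 h ∧ f p = u := by
          by_contra! hne
          exact hLv (mem_unlabeledVertically.2 ⟨hu, huS, hne⟩)
        exact Or.inr ⟨_, himg p hp hpu, hadj⟩
    calc domNum H ≤ _ := domNum_le_card hdom
      _ ≤ _ := card_union_le _ _
      _ ≤ _ := by gcongr; exact card_image_le
  have hS : ∑ u ∈ D, #{p ∈ S | f p = u} = #S :=
    (card_eq_sum_card_fiberwise fun p _ => mem_of_mem_labels (hf p)).symm
  have hL : ∑ u ∈ D, #{h | u ∈ unlabeled H D S f h} = ∑ h, #(unlabeled H D S f h) := by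
    change ∑ u ∈ D, #(bipartiteAbove (fun u h => u ∈ unlabeled H D S f h) univ u) = _
    rw [sum_card_bipartiteAbove_eq_sum_card_bipartiteBelow]
    refine sum_congr rfl fun h _ => congrArg card ?_
    ext u
    simp only [bipartiteBelow, mem_filter, and_iff_right_iff_imp]
    exact fun hu => unlabeledVertically_subset (unlabeled_subset hu)
  calc #D * domNum H = ∑ u ∈ D, domNum H := by simp
    _ ≤ _ := sum_le_sum hcell
    _ = _ := by rw [sum_add_distrib, hS, hL]

open Classical in
lemma card_unlabeledVertically_le [Fintype V] (hcard : #D = domNum G)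
    (hS : ∀ q, q ∈ S ∨ ∃ p ∈ S, (G □ H).Adj p q) (hf : ∀ p, f p ∈ labels G D p.1) (h : W) :
    #(unlabeledVertically H D S f h) ≤ #{x | x ∉ D ∧ (x, h) ∈ S} := by
  set L := unlabeledVertically H D S f h
  have hLD : L ⊆ D := unlabeledVertically_subset
  have hfiber : ∀ y, (y, h) ∈ S → y ∈ ({x | x ∉ D ∧ (x, h) ∈ S} : Finset V) ∪ D \ L := by
    intro y hy
    by_cases hyD : y ∈ D
    · simp [L, mem_unlabeledVertically, hyD, hy]
    · simp [hyD, hy]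
  have hdom : ∀ x, x ∈ ({x | x ∉ D ∧ (x, h) ∈ S} : Finset V) ∪ D \ L ∨
      ∃ y ∈ ({x | x ∉ D ∧ (x, h) ∈ S} : Finset V) ∪ D \ L, G.Adj y x := by
    intro x
    rcases hS (x, h) with hx | ⟨⟨y, k⟩, hp, hadj⟩
    · exact Or.inl (hfiber x hx)
    rcases SimpleGraph.boxProd_adj.1 hadj with ⟨hyx, hk⟩ | ⟨hkh, hyx⟩
    · obtain rfl : k = h := hk
      exact Or.inr ⟨y, hfiber y hp, hyx⟩
    · obtain rfl : y = x := hyx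
      have hmem : f (y, k) ∈ ({x | x ∉ D ∧ (x, h) ∈ S} : Finset V) ∪ D \ L := by
        refine mem_union_right _ (mem_sdiff.2 ⟨mem_of_mem_labels (hf _), fun hL => ?_⟩)
        exact (mem_unlabeledVertically.1 hL).2.2 (y, k) hp hkh rfl
      rcases eq_or_adj_of_mem_labels (hf (y, k)) with he | ha
      · left
        rw [← he] at hmem
        exact hmem
      · exact Or.inr ⟨_, hmem, ha⟩
  have h₁ := domNum_le_card hdom
  have h₂ := card_union_le ({x | x ∉ D ∧ (x, h) ∈ S} : Finset V) (D \ L)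
  have h₃ := card_sdiff_add_card_eq_card hLD
  omega

open Classical in
lemma card_filter_mem_unlabeled_le [Fintype V] [Fintype W] {d : ℕ}
    (hd : ∀ x ∉ D, #{u ∈ D | G.Adj x u} ≤ d + 1)
    (hS : ∀ q, q ∈ S ∨ ∃ p ∈ S, (G □ H).Adj p q) {u : V} (hu : u ∈ D) (h : W)
    (hC : ∀ b ∈ D, (b, h) ∈ S → ¬ G.Adj b u) :
    (d + 1) * #{f ∈ Fintype.piFinset fun p : V × W => labels G D p.1 |
        u ∈ unlabeled H D S f h} ≤
      d * #{f ∈ Fintype.piFinset fun p : V × W => labels G D p.1 |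
        u ∈ unlabeledVertically H D S f h} := by
  set Ω := Fintype.piFinset fun p : V × W => labels G D p.1
  by_cases hne : ∃ f ∈ Ω, u ∈ unlabeledVertically H D S f h
  swap
  · have : ({f ∈ Ω | u ∈ unlabeled H D S f h} : Finset _) = ∅ :=
      filter_eq_empty_iff.2 fun f hf hL => hne ⟨f, hf, unlabeled_subset hL⟩
    simp [this]
  obtain ⟨f, hf, hfL⟩ := hne
  have hfL' := (mem_unlabeledVertically.1 hfL).2
  obtain ⟨y, hyS, hyu⟩ : ∃ y, (y, h) ∈ S ∧ G.Adj y u := by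
    rcases hS (u, h) with hx | ⟨⟨y, k⟩, hp, hadj⟩
    · exact absurd hx hfL'.1
    rcases SimpleGraph.boxProd_adj.1 hadj with ⟨hyx, hk⟩ | ⟨hkh, hyx⟩
    · obtain rfl : k = h := hk
      exact ⟨y, hp, hyx⟩
    · obtain rfl : y = u := hyx
      have hlab := Fintype.mem_piFinset.1 hf (y, k)
      rw [labels_of_mem hu, mem_singleton] at hlab
      exact absurd hlab (hfL'.2 _ hp hkh)
  have hyD : y ∉ D := fun hyD => hC y hyD hyS hyu
  have hfib := Fintype.card_filter_piFinset_le_mul (A := fun p : V × W => labels G D p.1)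
    (P := fun f => u ∈ unlabeledVertically H D S f h) (i := (y, h)) (a := u)
    ((mem_labels_of_notMem hyD).2 ⟨hu, hyu⟩) (by
      intro g hg
      rw [mem_unlabeledVertically] at hg ⊢
      refine ⟨hg.1, hg.2.1, fun p hp hadj => ?_⟩
      have hne : p ≠ (y, h) := by
        rintro rfl
        exact hadj.ne rfl
      simpa [hne] using hg.2.2 p hp hadj)
  have hsize : #(labels G D y) ≤ d + 1 := by
    have := hd y hyD
    simpa [labels, hyD] using this
  have hsplit : #{f ∈ Ω | u ∈ unlabeled H D S f h} +
      #{f ∈ Ω | u ∈ unlabeledVertically H D S f h ∧ f (y, h) = u} ≤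
      #{f ∈ Ω | u ∈ unlabeledVertically H D S f h} := by
    rw [← card_union_of_disjoint]
    · refine card_le_card (union_subset ?_ ?_)
      · exact fun g hg => mem_filter.2
          ⟨(mem_filter.1 hg).1, unlabeled_subset (mem_filter.1 hg).2⟩
      · exact fun g hg => mem_filter.2 ⟨(mem_filter.1 hg).1, (mem_filter.1 hg).2.1⟩
    · refine disjoint_left.2 fun g hg hg' => ?_
      exact (mem_unlabeled.1 (mem_filter.1 hg).2).2 (y, h) hyS rfl (mem_filter.1 hg').2.2
  have hfib' := hfib.trans (Nat.mul_le_mul_right _ hsize)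
  nlinarith

open Classical in
lemma sum_card_unlabeled_le [Fintype V] [Fintype W] {d : ℕ} (hcard : #D = domNum G)
    (hd : ∀ x ∉ D, #{u ∈ D | G.Adj x u} ≤ d + 1) (hd' : ∀ x ∈ D, #{u ∈ D | G.Adj x u} ≤ d)
    (hS : ∀ q, q ∈ S ∨ ∃ p ∈ S, (G □ H).Adj p q) (h : W) :
    (d + 1) * ∑ f ∈ Fintype.piFinset fun p : V × W => labels G D p.1, #(unlabeled H D S f h) ≤
      d * (#(Fintype.piFinset fun p : V × W => labels G D p.1) * #{p ∈ S | p.2 = h}) := by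
  set Ω := Fintype.piFinset fun p : V × W => labels G D p.1
  set B : Finset V := {b ∈ D | (b, h) ∈ S}
  set T : Finset V := {x | x ∉ D ∧ (x, h) ∈ S}
  set C : Finset V := B.biUnion fun b => {u ∈ D | G.Adj b u}
  have hCD : C ⊆ D := biUnion_subset.2 fun b _ => filter_subset _ _
  have hCcard : #C ≤ #B * d :=
    card_biUnion_le_card_mul _ _ _ fun b hb => hd' b (mem_filter.1 hb).1
  have hTB : #T + #B = #{p ∈ S | p.2 = h} := by
    rw [← card_union_of_disjoint (disjoint_left.2 fun x hx hx' =>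
      (mem_filter.1 hx).2.1 (mem_filter.1 hx').1)]
    refine card_bij (fun x _ => (x, h)) ?_ ?_ ?_
    · intro x hx
      simp only [T, B, mem_union, mem_filter, mem_univ, true_and] at hx ⊢
      tauto
    · intro x _ y _ hxy
      exact (Prod.ext_iff.1 hxy).1
    · rintro ⟨x, k⟩ hp
      obtain ⟨hp, rfl⟩ := mem_filter.1 hp
      refine ⟨x, ?_, rfl⟩
      simp only [T, B, mem_union, mem_filter, mem_univ, true_and]
      tauto
  have hswap : ∀ L : (V × W → V) → Finset V, (∀ f, L f ⊆ D) →
      ∑ f ∈ Ω, #(L f) = ∑ u ∈ D, #{f ∈ Ω | u ∈ L f} := by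
    intro L hL
    change _ = ∑ u ∈ D, #(bipartiteAbove (fun u f => u ∈ L f) Ω u)
    rw [sum_card_bipartiteAbove_eq_sum_card_bipartiteBelow]
    refine sum_congr rfl fun f _ => congrArg card ?_
    ext u
    simpa [bipartiteBelow] using @hL f u
  have hpoint : ∀ u ∈ D, (d + 1) * #{f ∈ Ω | u ∈ unlabeled H D S f h} ≤
      d * #{f ∈ Ω | u ∈ unlabeledVertically H D S f h} + if u ∈ C then #Ω else 0 := by
    intro u hu
    split_ifs with huC
    · have h₁ : #{f ∈ Ω | u ∈ unlabeled H D S f h} ≤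
          #{f ∈ Ω | u ∈ unlabeledVertically H D S f h} :=
        card_le_card (monotone_filter_right _ fun f _ hf => unlabeled_subset hf)
      have h₂ : #{f ∈ Ω | u ∈ unlabeled H D S f h} ≤ #Ω := card_filter_le _ _
      nlinarith
    · refine card_filter_mem_unlabeled_le hd hS hu h fun b hb hbS hbu => huC ?_
      exact mem_biUnion.2 ⟨b, mem_filter.2 ⟨hb, hbS⟩, mem_filter.2 ⟨hu, hbu⟩⟩
  have hvert : ∑ f ∈ Ω, #(unlabeledVertically H D S f h) ≤ #Ω * #T := by
    refine sum_le_card_nsmul _ _ _ fun f hf => ?_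
    exact card_unlabeledVertically_le hcard hS (fun p => Fintype.mem_piFinset.1 hf p) h
  have hsumC : ∑ u ∈ D, (if u ∈ C then #Ω else 0) = #C * #Ω := by
    rw [← sum_filter, filter_mem_eq_inter, inter_eq_right.2 hCD, sum_const, smul_eq_mul]
  calc (d + 1) * ∑ f ∈ Ω, #(unlabeled H D S f h)
      = ∑ u ∈ D, (d + 1) * #{f ∈ Ω | u ∈ unlabeled H D S f h} := by
        rw [hswap _ fun f => unlabeled_subset.trans unlabeledVertically_subset, mul_sum]
    _ ≤ ∑ u ∈ D, (d * #{f ∈ Ω | u ∈ unlabeledVertically H D S f h} +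
          if u ∈ C then #Ω else 0) := sum_le_sum hpoint
    _ = d * ∑ f ∈ Ω, #(unlabeledVertically H D S f h) + #C * #Ω := by
        rw [sum_add_distrib, hsumC, ← mul_sum, ← hswap _ fun f => unlabeledVertically_subset]
    _ ≤ d * (#Ω * #T) + #B * d * #Ω := by gcongr
    _ = d * (#Ω * #{p ∈ S | p.2 = h}) := by rw [← hTB]; ring

end Labelings

open Classical in
/-- The natural-number form of the bound, for a minimum dominating set `D` of `G` such that every
vertex outside `D` has at most `d + 1`, and every vertex of `D` at most `d`, neighbors in `D`. -/
lemma mul_domNum_mul_domNum_le {V W : Type*} [Fintype V] [Fintype W] {G : SimpleGraph V}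
    {H : SimpleGraph W} {D : Finset V} {d : ℕ} (hD : ∀ v, v ∈ D ∨ ∃ u ∈ D, G.Adj u v)
    (hcard : #D = domNum G) (hd : ∀ x ∉ D, #{u ∈ D | G.Adj x u} ≤ d + 1)
    (hd' : ∀ x ∈ D, #{u ∈ D | G.Adj x u} ≤ d) :
    (d + 1) * (domNum G * domNum H) ≤ (2 * d + 1) * domNum (G □ H) := by
  obtain ⟨S, hS, hScard⟩ := exists_card_eq_domNum (G □ H)
  set Ω := Fintype.piFinset fun p : V × W => labels G D p.1
  have hpos : 0 < #Ω :=
    card_pos.2 (Fintype.piFinset_nonempty.2 fun p => labels_nonempty hD p.1)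
  have h₁ : #Ω * (#D * domNum H) ≤ #Ω * #S + ∑ f ∈ Ω, ∑ h, #(unlabeled H D S f h) := by
    rw [← smul_eq_mul, ← sum_const, ← smul_eq_mul (#Ω), ← sum_const, ← sum_add_distrib]
    exact sum_le_sum fun f hf => card_mul_domNum_le fun p => Fintype.mem_piFinset.1 hf p
  have h₂ : (d + 1) * ∑ f ∈ Ω, ∑ h, #(unlabeled H D S f h) ≤ d * (#Ω * #S) := by
    rw [sum_comm, mul_sum, card_eq_sum_card_fiberwise (s := S) (t := univ) (f := Prod.snd)
      (fun _ _ => by simp), mul_sum, mul_sum]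
    exact sum_le_sum fun h _ => sum_card_unlabeled_le hcard hd hd' hS h
  rw [← hcard, ← hScard]
  refine Nat.le_of_mul_le_mul_left ?_ hpos
  nlinarith

/-- For finite nonempty graphs `G`, `H` without isolated vertices,
`γ(G □ H) ≥ (Δ(G)/(2Δ(G)−1))·γ(G)·γ(H)`. -/
theorem domNum_boxProd_ge_maxDegree_bound {V W : Type*} [Fintype V] [Fintype W]
    [Nonempty V] [Nonempty W] (G : SimpleGraph V) (H : SimpleGraph W)
    [DecidableRel G.Adj]
    (hG : ∀ v : V, ∃ u : V, G.Adj u v) (hH : ∀ w : W, ∃ u : W, H.Adj u w) :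
    (domNum (G □ H) : ℝ) ≥
      (G.maxDegree : ℝ) / (2 * (G.maxDegree : ℝ) - 1) * (domNum G : ℝ) * (domNum H : ℝ) := by
  classical
  obtain ⟨D, hD, hcard⟩ := exists_card_eq_domNum G
  have hpos : 0 < G.maxDegree := by
    obtain ⟨v⟩ := ‹Nonempty V›
    obtain ⟨u, hu⟩ := hG v
    exact (G.degree_pos_iff_exists_adj v).2 ⟨u, hu.symm⟩ |>.trans_le (G.degree_le_maxDegree v)
  obtain ⟨d, hd⟩ : ∃ d, G.maxDegree = d + 1 := ⟨_, (Nat.succ_pred_eq_of_pos hpos).symm⟩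
  have hnbr : ∀ x, ({u ∈ D | G.Adj x u} : Finset V) ⊆ G.neighborFinset x := fun x u hu => by
    simpa using (mem_filter.1 hu).2
  have hle : ∀ x, #(G.neighborFinset x) ≤ d + 1 := fun x => by
    rw [G.card_neighborFinset_eq_degree, ← hd]
    exact G.degree_le_maxDegree x
  have key := mul_domNum_mul_domNum_le (H := H) (d := d) hD hcard
    (fun x _ => by
      have : #{u ∈ D | G.Adj x u} ≤ d + 1 := (card_le_card (hnbr x)).trans (hle x)
      convert this)
    (fun x hx => by
      obtain ⟨y, hyD, hxy⟩ := exists_adj_notMem_of_card_eq_domNum hG hD hcard hx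
      have hlt : #{u ∈ D | G.Adj x u} < #(G.neighborFinset x) :=
        card_lt_card ((ssubset_iff_of_subset (hnbr x)).2
          ⟨y, by simpa using hxy, fun hy => hyD (mem_filter.1 hy).1⟩)
      have := Nat.le_of_lt_succ (hlt.trans_le (hle x))
      convert this)
  have keyR : ((d : ℝ) + 1) * (domNum G * domNum H) ≤ (2 * d + 1) * domNum (G □ H) := by
    exact_mod_cast key
  have hden : (0 : ℝ) < 2 * ((d : ℝ) + 1) - 1 := by
    have : (0 : ℝ) ≤ d := d.cast_nonneg
    linarith
  rw [hd, ge_iff_le, mul_assoc, div_mul_eq_mul_div]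
  push_cast
  rw [div_le_iff₀ hden]
  linarith
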